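/- For any fixed real h₁ and h₂, the map σ ↦ T(σ; h₁, h₂) is injective on (−1, 1); that is, for σ, σ′ ∈ (−1, 1), if T(σ; h₁, h₂) = T(σ′; h₁, h₂) then σ = σ′. Consequently, for fixed thresholds there is a one-to-one correspondence between the correlation parameter σ and the joint exceedance probability τ = T(σ; h₁, h₂), so the bridge equation determines σ uniquely. -/

import Mathlib

open Real Set

/-- The joint exceedance probability of a standard bivariate normal with correlation `σ`:
`T σ h₁ h₂ = P(X > h₁, Y > h₂)`. -/
noncomputable def bivariateNormalTail (σ h₁ h₂ : ℝ) : ℝ :=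
  ∫ x in Set.Ioi h₁, ∫ y in Set.Ioi h₂,
    (2 * Real.pi * Real.sqrt (1 - σ ^ 2))⁻¹ *
      Real.exp (-(x ^ 2 - 2 * σ * x * y + y ^ 2) / (2 * (1 - σ ^ 2)))

open MeasureTheory in
theorem setIntegral_pos_of_forall_pos {f : ℝ → ℝ} {s : Set ℝ} (hs : MeasurableSet s)
    (hs0 : volume s ≠ 0) (hf : IntegrableOn f s) (hpos : ∀ x ∈ s, 0 < f x) :
    0 < ∫ x in s, f x := by
  rw [setIntegral_pos_iff_support_of_nonneg_ae _ hf]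
  · rw [inter_eq_right.mpr (show s ⊆ Function.support f from fun x hx => (hpos x hx).ne')]
    exact pos_iff_ne_zero.mpr hs0
  · filter_upwards [ae_restrict_mem hs] with x hx using (hpos x hx).le

open MeasureTheory in
/-- A function of zero integral which crosses from negative to positive values exactly once has
positive upper tail integrals. -/
theorem setIntegral_Ioi_pos_of_single_crossing {f : ℝ → ℝ} {c : ℝ} (hf : Integrable f)
    (hzero : ∫ x, f x = 0) (hneg : ∀ x < c, f x < 0) (hpos : ∀ x, c < x → 0 < f x) (h : ℝ) :
    0 < ∫ x in Ioi h, f x := by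
  rcases le_or_gt c h with hc | hc
  · exact setIntegral_pos_of_forall_pos measurableSet_Ioi (by simp) hf.integrableOn
      fun x hx => hpos x (hc.trans_lt hx)
  · have h_neg : 0 < ∫ x in Iic h, -f x :=
      setIntegral_pos_of_forall_pos measurableSet_Iic (by simp) hf.neg.integrableOn
        fun x hx => neg_pos.mpr (hneg x (lt_of_le_of_lt hx hc))
    rw [integral_neg] at h_neg
    have h_split := intervalIntegral.integral_Iic_add_Ioi (b := h) hf.integrableOn hf.integrableOn
    linarith

open MeasureTheory in
theorem integrable_exp_neg_half_sq : Integrable fun t : ℝ => exp (-t ^ 2 / 2) := by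
  convert integrable_exp_neg_mul_sq (b := 1 / 2) (by norm_num) using 3
  ring

open MeasureTheory in
theorem strictAnti_setIntegral_Ioi_exp_neg_half_sq :
    StrictAnti fun a : ℝ => ∫ t in Ioi a, exp (-t ^ 2 / 2) := by
  intro a b hab
  have h_split := intervalIntegral.integral_interval_add_Ioi (a := a) (b := b)
    integrable_exp_neg_half_sq.integrableOn integrable_exp_neg_half_sq.integrableOn
  have h_pos : 0 < ∫ t in a..b, exp (-t ^ 2 / 2) :=
    intervalIntegral.intervalIntegral_pos_of_pos
      integrable_exp_neg_half_sq.intervalIntegrable (fun t => exp_pos _) hab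
  dsimp only
  linarith

theorem one_sub_sq_pos_of_mem_Ioo {σ : ℝ} (hσ : σ ∈ Ioo (-1 : ℝ) 1) : 0 < 1 - σ ^ 2 := by
  nlinarith [hσ.1, hσ.2]

/-- The density of the standard bivariate normal law with correlation `σ`. -/
noncomputable def bivariateNormalDensity (σ x y : ℝ) : ℝ :=
  (2 * Real.pi * Real.sqrt (1 - σ ^ 2))⁻¹ *
    Real.exp (-(x ^ 2 - 2 * σ * x * y + y ^ 2) / (2 * (1 - σ ^ 2)))

theorem bivariateNormalDensity_comm (σ x y : ℝ) :
    bivariateNormalDensity σ x y = bivariateNormalDensity σ y x := by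
  unfold bivariateNormalDensity
  ring_nf

theorem bivariateNormalDensity_eq_mul {σ : ℝ} (hσ : σ ∈ Ioo (-1 : ℝ) 1) (x y : ℝ) :
    bivariateNormalDensity σ x y = (2 * π * √(1 - σ ^ 2))⁻¹ * exp (-x ^ 2 / 2) *
      exp (-((√(1 - σ ^ 2))⁻¹ * (y - σ * x)) ^ 2 / 2) := by
  have hpos := one_sub_sq_pos_of_mem_Ioo hσ
  rw [bivariateNormalDensity, mul_assoc _ (exp _), ← exp_add, mul_pow, inv_pow, sq_sqrt hpos.le]
  congr 2
  field_simp
  ring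

open MeasureTheory in
theorem integral_bivariateNormalDensity {σ : ℝ} (hσ : σ ∈ Ioo (-1 : ℝ) 1) (x : ℝ) :
    ∫ y, bivariateNormalDensity σ x y =
      (2 * π)⁻¹ * exp (-x ^ 2 / 2) * ∫ t, exp (-t ^ 2 / 2) := by
  have hs : 0 < √(1 - σ ^ 2) := sqrt_pos.mpr (one_sub_sq_pos_of_mem_Ioo hσ)
  simp_rw [bivariateNormalDensity_eq_mul hσ, integral_const_mul]
  rw [integral_sub_right_eq_self (fun y => exp (-((√(1 - σ ^ 2))⁻¹ * y) ^ 2 / 2)),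
    Measure.integral_comp_mul_left (fun t => exp (-t ^ 2 / 2)), inv_inv, abs_of_pos hs,
    smul_eq_mul]
  field_simp

open MeasureTheory in
theorem setIntegral_Ioi_bivariateNormalDensity {σ : ℝ} (hσ : σ ∈ Ioo (-1 : ℝ) 1) (x h : ℝ) :
    ∫ y in Ioi h, bivariateNormalDensity σ x y =
      (2 * π)⁻¹ * exp (-x ^ 2 / 2) *
        ∫ t in Ioi ((√(1 - σ ^ 2))⁻¹ * (h - σ * x)), exp (-t ^ 2 / 2) := by
  have hs : 0 < √(1 - σ ^ 2) := sqrt_pos.mpr (one_sub_sq_pos_of_mem_Ioo hσ)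
  simp_rw [bivariateNormalDensity_eq_mul hσ, integral_const_mul]
  have h_shift := (measurePreserving_sub_right volume (σ * x)).setIntegral_preimage_emb
    (measurableEmbedding_subRight (σ * x))
    (fun y => exp (-((√(1 - σ ^ 2))⁻¹ * y) ^ 2 / 2)) (Ioi (h - σ * x))
  have h_pre : (fun y => y - σ * x) ⁻¹' Ioi (h - σ * x) = Ioi h := by ext; simp
  rw [h_pre] at h_shift
  rw [h_shift, integral_comp_mul_left_Ioi (fun t => exp (-t ^ 2 / 2)) _ (inv_pos.mpr hs),
    inv_inv, smul_eq_mul]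
  field_simp

open MeasureTheory in
theorem integrable_bivariateNormalDensity {σ : ℝ} (hσ : σ ∈ Ioo (-1 : ℝ) 1) :
    Integrable (Function.uncurry (bivariateNormalDensity σ)) (volume.prod volume) := by
  have hpos := one_sub_sq_pos_of_mem_Ioo hσ
  have h_abs : |σ| < 1 := abs_lt.mpr hσ
  set b := (1 - |σ|) / 2 with hb
  have hg : Integrable fun t : ℝ => exp (-b * t ^ 2) :=
    integrable_exp_neg_mul_sq (by rw [hb]; linarith)
  refine ((hg.mul_prod hg).const_mul (2 * π * √(1 - σ ^ 2))⁻¹).mono' ?_ ?_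
  · unfold bivariateNormalDensity Function.uncurry
    exact Continuous.aestronglyMeasurable (by fun_prop)
  · refine Filter.Eventually.of_forall fun ⟨x, y⟩ => ?_
    simp only [Function.uncurry_apply_pair, bivariateNormalDensity]
    rw [norm_of_nonneg (by positivity), ← exp_add]
    gcongr
    have h_cross : 2 * σ * x * y ≤ |σ| * (x ^ 2 + y ^ 2) := by
      rcases abs_cases σ with ⟨h, h'⟩ | ⟨h, h'⟩ <;> rw [h]
      · nlinarith [mul_nonneg h' (sq_nonneg (x - y))]
      · nlinarith [mul_nonneg (neg_nonneg.mpr h'.le) (sq_nonneg (x + y))]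
    rw [div_le_iff₀ (by positivity), hb]
    have h_nonneg : 0 ≤ (1 - |σ|) * (x ^ 2 + y ^ 2) :=
      mul_nonneg (by linarith) (by positivity)
    nlinarith [mul_nonneg h_nonneg (sq_nonneg σ)]

open MeasureTheory in
theorem integrable_bivariateNormalDensity_restrict {σ : ℝ} (hσ : σ ∈ Ioo (-1 : ℝ) 1) (h : ℝ) :
    Integrable (Function.uncurry (bivariateNormalDensity σ))
      (volume.prod (volume.restrict (Ioi h))) := by
  have h_int := (integrable_bivariateNormalDensity hσ).restrict (s := univ ×ˢ Ioi h)
  rwa [← Measure.prod_restrict, Measure.restrict_univ] at h_int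

open MeasureTheory in
theorem integral_setIntegral_bivariateNormalDensity {σ : ℝ} (hσ : σ ∈ Ioo (-1 : ℝ) 1) (h : ℝ) :
    ∫ x, ∫ y in Ioi h, bivariateNormalDensity σ x y =
      ∫ y in Ioi h, (2 * π)⁻¹ * exp (-y ^ 2 / 2) * ∫ t, exp (-t ^ 2 / 2) := by
  rw [integral_integral_swap (integrable_bivariateNormalDensity_restrict hσ h)]
  simp_rw [fun x y => bivariateNormalDensity_comm σ x y, integral_bivariateNormalDensity hσ]

theorem div_sqrt_one_sub_sq_strictMonoOn :
    StrictMonoOn (fun σ : ℝ => (√(1 - σ ^ 2))⁻¹ * σ) (Ioo (-1) 1) := by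
  intro a ha b hb hab
  have hsa := sqrt_pos.mpr (one_sub_sq_pos_of_mem_Ioo ha)
  have hsb := sqrt_pos.mpr (one_sub_sq_pos_of_mem_Ioo hb)
  have hqa := sq_sqrt (one_sub_sq_pos_of_mem_Ioo ha).le
  have hqb := sq_sqrt (one_sub_sq_pos_of_mem_Ioo hb).le
  dsimp only
  rw [inv_mul_eq_div, inv_mul_eq_div, div_lt_div_iff₀ hsa hsb]
  rcases le_or_gt 0 a with h0 | h0
  · have : √(1 - b ^ 2) ≤ √(1 - a ^ 2) := sqrt_le_sqrt (by nlinarith)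
    nlinarith
  · rcases le_or_gt b 0 with h1 | h1
    · have : √(1 - a ^ 2) ≤ √(1 - b ^ 2) := sqrt_le_sqrt (by nlinarith)
      nlinarith
    · nlinarith [mul_pos h1 hsa, mul_pos (neg_pos.mpr h0) hsb]

open MeasureTheory in
theorem bivariateNormalTail_strictMonoOn (h₁ h₂ : ℝ) :
    StrictMonoOn (fun σ => bivariateNormalTail σ h₁ h₂) (Ioo (-1 : ℝ) 1) := by
  intro a ha b hb hab
  have h_int : ∀ {σ : ℝ}, σ ∈ Ioo (-1 : ℝ) 1 →
      Integrable fun x => ∫ y in Ioi h₂, bivariateNormalDensity σ x y := fun hσ =>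
    (integrable_bivariateNormalDensity_restrict hσ h₂).integral_prod_left
  have h_slope := sub_pos.mpr (div_sqrt_one_sub_sq_strictMonoOn ha hb hab)
  dsimp only at h_slope
  set p := (√(1 - a ^ 2))⁻¹ with hp
  set q := (√(1 - b ^ 2))⁻¹ with hq
  have h_scale : ∀ x : ℝ, 0 < (2 * π)⁻¹ * exp (-x ^ 2 / 2) := fun x => by positivity
  have h_tail : 0 < ∫ x in Ioi h₁, ((∫ y in Ioi h₂, bivariateNormalDensity b x y) -
      ∫ y in Ioi h₂, bivariateNormalDensity a x y) := by
    refine setIntegral_Ioi_pos_of_single_crossing (c := (q - p) * h₂ / (q * b - p * a))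
      ((h_int hb).sub (h_int ha)) ?_ ?_ ?_ h₁ <;> simp only [Pi.sub_apply]
    · rw [integral_sub (h_int hb) (h_int ha), integral_setIntegral_bivariateNormalDensity hb,
        integral_setIntegral_bivariateNormalDensity ha, sub_self]
    · intro x hx
      rw [lt_div_iff₀ h_slope] at hx
      rw [setIntegral_Ioi_bivariateNormalDensity hb, setIntegral_Ioi_bivariateNormalDensity ha,
        sub_neg]
      refine mul_lt_mul_of_pos_left (strictAnti_setIntegral_Ioi_exp_neg_half_sq ?_) (h_scale x)
      rw [← hp, ← hq]
      linarith
    · intro x hx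
      rw [div_lt_iff₀ h_slope] at hx
      rw [setIntegral_Ioi_bivariateNormalDensity hb, setIntegral_Ioi_bivariateNormalDensity ha,
        sub_pos]
      refine mul_lt_mul_of_pos_left (strictAnti_setIntegral_Ioi_exp_neg_half_sq ?_) (h_scale x)
      rw [← hp, ← hq]
      linarith
  rw [integral_sub (h_int hb).integrableOn (h_int ha).integrableOn] at h_tail
  exact sub_pos.mp h_tail

/-- for fixed thresholds `h₁, h₂`, the map `σ ↦ T(σ; h₁, h₂)` is injective on
`(-1, 1)`: the bridge equation determines the correlation `σ` uniquely from the joint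
exceedance probability. -/
theorem bivariateNormalTail_injOn (h₁ h₂ : ℝ) :
    Set.InjOn (fun σ => bivariateNormalTail σ h₁ h₂) (Set.Ioo (-1 : ℝ) 1) :=
  (bivariateNormalTail_strictMonoOn h₁ h₂).injOn
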